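/- arXiv:2206.10031 — 3 statements merged into one kernel-verified Lean document; each statement's English description precedes it below -/
import Mathlib

section
/- Let k be a field of characteristic zero and let C be a skeletal category with finitely many objects and with all hom-sets finite, such that every endomorphism in C is an isomorphism. Let F : C → Vect_k be a functor. For each pair of objects c, d, the linear map F(c) → F(d)_{Aut(d)} sending v to the class of ∑_{f ∈ Hom_C(c,d)} F(f)(v) descends to the coinvariants F(c)_{Aut(c)}; hence these components assemble into a well-defined k-linear endomorphism Φ of the direct sum ⊕_{c ∈ Ob(C)} F(c)_{Aut(c)}. This endomorphism Φ is invertible. -/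
open CategoryTheory

/-- For a functor `F : C ⥤ ModuleCat k` and an object `c`, the submodule of `F(c)`
spanned by the elements `v - F(α)(v)` for automorphisms `α` of `c`; the quotient by
it is the module of coinvariants `F(c)_{Aut(c)}`. -/
def autCoinvariantsKer {k : Type*} [Field k] {C : Type*} [Category C]
    (F : C ⥤ ModuleCat k) (c : C) : Submodule k (F.obj c) :=
  Submodule.span k {x | ∃ (α : Aut c) (v : F.obj c), x = v - F.map α.hom v}

/-- A lower triangular endomorphism of a finite product of modules, indexed by a partial order,
is bijective when its diagonal blocks are nonzero scalars. -/
theorem LinearMap.bijective_of_lowerTriangular {k ι : Type*} [Field k] [PartialOrder ι]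
    [Fintype ι] [DecidableEq ι] {M : ι → Type*} [∀ i, AddCommGroup (M i)] [∀ i, Module k (M i)]
    (Φ : ((i : ι) → M i) →ₗ[k] ((i : ι) → M i)) (a : ι → k) (ha : ∀ i, a i ≠ 0)
    (hdiag : ∀ i x, Φ (Pi.single i x) i = a i • x)
    (htri : ∀ i j x, ¬ i ≤ j → Φ (Pi.single i x) j = 0) :
    Function.Bijective Φ := by
  have apply_eq_sum (x : (i : ι) → M i) (j : ι) : Φ x j = ∑ i, Φ (Pi.single i (x i)) j := by
    conv_lhs => rw [← Finset.univ_sum_single x, map_sum, Finset.sum_apply]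
  constructor
  · rw [injective_iff_map_eq_zero]
    intro x hx
    funext j
    induction j using WellFoundedLT.induction with
    | ind j ih =>
      have h := apply_eq_sum x j
      rw [hx, Finset.sum_eq_single j, hdiag] at h
      · exact (smul_eq_zero.mp h.symm).resolve_left (ha j)
      · intro i _ hij
        by_cases hle : i ≤ j
        · simp [ih i (lt_of_le_of_ne hle hij)]
        · exact htri i j _ hle
      · simp
  · have single_mem (i : ι) : ∀ x : M i, Pi.single i x ∈ LinearMap.range Φ := by
      induction i using WellFoundedGT.induction with
      | ind i ih =>
        intro x
        have h : Φ (Pi.single i ((a i)⁻¹ • x)) =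
            Pi.single i x + ∑ j ∈ Finset.univ.erase i,
              Pi.single j (Φ (Pi.single i ((a i)⁻¹ • x)) j) := by
          conv_lhs => rw [← Finset.univ_sum_single (Φ (Pi.single i ((a i)⁻¹ • x)))]
          rw [← Finset.add_sum_erase _ _ (Finset.mem_univ i), hdiag,
            smul_inv_smul₀ (ha i)]
        rw [eq_sub_of_add_eq h.symm]
        refine sub_mem (LinearMap.mem_range_self _ _) (sum_mem fun j hj => ?_)
        by_cases hle : i ≤ j
        · exact ih j (lt_of_le_of_ne hle (Finset.ne_of_mem_erase hj).symm) _
        · simp [htri i j _ hle]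
    intro y
    rw [← LinearMap.mem_range, ← Finset.univ_sum_single y]
    exact sum_mem fun i _ => single_mem i (y i)

/-- In a skeletal category whose endomorphisms are isomorphisms, the existence of a morphism
is a partial order on the objects. -/
abbrev CategoryTheory.Skeletal.homPartialOrder {C : Type*} [Category C] (hskel : Skeletal C)
    (hendo : ∀ (c : C) (f : c ⟶ c), IsIso f) : PartialOrder C where
  le c d := Nonempty (c ⟶ d)
  le_refl c := ⟨𝟙 c⟩
  le_trans _ _ _ := fun ⟨f⟩ ⟨g⟩ => ⟨f ≫ g⟩
  le_antisymm c d := fun ⟨f⟩ ⟨g⟩ => by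
    have := hendo c (f ≫ g)
    have := hendo d (g ≫ f)
    have : IsSplitMono f := ⟨⟨g ≫ inv (f ≫ g), by rw [← Category.assoc, IsIso.hom_inv_id]⟩⟩
    have : Epi f := epi_of_epi g f
    have := isIso_of_epi_of_isSplitMono f
    exact hskel ⟨asIso f⟩

section

variable {k : Type*} [Field k] {C : Type*} [Category C] (F : C ⥤ ModuleCat k)

theorem mk_map_eq_mk_of_isIso {c : C} (f : c ⟶ c) [IsIso f] (v : F.obj c) :
    (Submodule.Quotient.mk (F.map f v) : F.obj c ⧸ autCoinvariantsKer F c) =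
      Submodule.Quotient.mk v :=
  .symm <| (Submodule.Quotient.eq (autCoinvariantsKer F c)).mpr <|
    Submodule.subset_span ⟨asIso f, v, rfl⟩

/-- The map `F(c)_{Aut(c)} → F(d)_{Aut(d)}` induced by `v ↦ ∑_{f : c ⟶ d} F(f)(v)`. -/
noncomputable def coinvariantsHomSum (c d : C) [Fintype (c ⟶ d)] :
    (F.obj c ⧸ autCoinvariantsKer F c) →ₗ[k] (F.obj d ⧸ autCoinvariantsKer F d) :=
  (autCoinvariantsKer F c).liftQ
    ((autCoinvariantsKer F d).mkQ ∘ₗ ∑ f : c ⟶ d, (F.map f).hom) <| by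
      rw [autCoinvariantsKer, Submodule.span_le]
      rintro _ ⟨α, v, rfl⟩
      have h : ∑ f : c ⟶ d, F.map f (F.map α.hom v) = ∑ f : c ⟶ d, F.map f v :=
        Fintype.sum_equiv (α.homFromEquiv (Z := d)).symm _ _ fun f => by
          rw [← ConcreteCategory.comp_apply, ← F.map_comp]
          rfl
      simp [h]

theorem coinvariantsHomSum_mk (c d : C) [Fintype (c ⟶ d)] (v : F.obj c) :
    coinvariantsHomSum F c d (Submodule.Quotient.mk v) =
      Submodule.Quotient.mk (∑ f : c ⟶ d, F.map f v) := by
  rw [← Submodule.mkQ_apply (autCoinvariantsKer F d), map_sum]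
  simp [coinvariantsHomSum]

theorem coinvariantsHomSum_self (c : C) [Fintype (c ⟶ c)] (hendo : ∀ f : c ⟶ c, IsIso f)
    (x : F.obj c ⧸ autCoinvariantsKer F c) :
    coinvariantsHomSum F c c x = (Fintype.card (c ⟶ c) : k) • x := by
  obtain ⟨v, rfl⟩ := Submodule.Quotient.mk_surjective _ x
  rw [coinvariantsHomSum_mk, ← Submodule.mkQ_apply, map_sum]
  simp [mk_map_eq_mk_of_isIso, Nat.cast_smul_eq_nsmul]

theorem coinvariantsHomSum_of_isEmpty (c d : C) [Fintype (c ⟶ d)] [IsEmpty (c ⟶ d)]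
    (x : F.obj c ⧸ autCoinvariantsKer F c) :
    coinvariantsHomSum F c d x = 0 := by
  obtain ⟨v, rfl⟩ := Submodule.Quotient.mk_surjective _ x
  simp [coinvariantsHomSum_mk]

end

/-- Let `k` be a field of characteristic zero and `C` a skeletal category
with finitely many objects and finite hom-sets in which every endomorphism is an
isomorphism, and let `F : C ⥤ Vect_k`. The maps `F(c) → F(d)_{Aut(d)}`,
`v ↦ [∑_{f : c ⟶ d} F(f)(v)]`, descend to the coinvariants `F(c)_{Aut(c)}` and
assemble into a linear endomorphism `Φ` of `⊕_{c} F(c)_{Aut(c)}`, characterized by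
its values on the classes of `Pi.single` elements; this `Φ` is invertible. -/
theorem moebius_inversion_finite_category {k : Type*} [Field k] [CharZero k]
    {C : Type*} [Category C] [Fintype C] [DecidableEq C] [∀ c d : C, Fintype (c ⟶ d)]
    (hskel : Skeletal C) (hendo : ∀ (c : C) (f : c ⟶ c), IsIso f)
    (F : C ⥤ ModuleCat k) :
    ∃ Φ : ((c : C) → (F.obj c ⧸ autCoinvariantsKer F c)) →ₗ[k]
        ((c : C) → (F.obj c ⧸ autCoinvariantsKer F c)),
      (∀ (c : C) (v : F.obj c),
        Φ (Pi.single c (Submodule.Quotient.mk v)) =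
          fun d => Submodule.Quotient.mk (∑ f : c ⟶ d, F.map f v)) ∧
      Function.Bijective Φ := by
  let Φ := LinearMap.lsum k (fun c => F.obj c ⧸ autCoinvariantsKer F c) k
    fun c => LinearMap.pi fun d => coinvariantsHomSum F c d
  have hΦ (c : C) (x : F.obj c ⧸ autCoinvariantsKer F c) (d : C) :
      Φ (Pi.single c x) d = coinvariantsHomSum F c d x := by
    simp only [Φ, LinearMap.lsum_piSingle, LinearMap.pi_apply]
  refine ⟨Φ, fun c v => funext fun d => by rw [hΦ, coinvariantsHomSum_mk], ?_⟩
  let := hskel.homPartialOrder hendo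
  refine Φ.bijective_of_lowerTriangular (fun c => (Fintype.card (c ⟶ c) : k))
    (fun c => ?_) (fun c x => ?_) (fun c d x hcd => ?_)
  · have : Nonempty (c ⟶ c) := ⟨𝟙 c⟩
    exact Nat.cast_ne_zero.mpr Fintype.card_ne_zero
  · rw [hΦ, coinvariantsHomSum_self F c (hendo c)]
  · have : IsEmpty (c ⟶ d) := not_nonempty_iff.mp hcd
    rw [hΦ, coinvariantsHomSum_of_isEmpty]
end

section
/- Let C be a category in which every endomorphism is an isomorphism, and let f₁ : a₀ → a₁, f₂ : a₁ → a₂, …, fₙ : a_{n−1} → aₙ be a composable sequence of morphisms of C none of which is an isomorphism. Then the objects a₀, a₁, …, aₙ are pairwise non-isomorphic. In particular, if C has exactly r isomorphism classes of objects then n + 1 ≤ r, so any such chain has length at most r − 1. -/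
open CategoryTheory

/-- If every endomorphism is an isomorphism, then so is every morphism that has some morphism
in the opposite direction. -/
lemma isIso_of_hom_of_forall_isIso_endo {C : Type*} [Category C]
    (hendo : ∀ (c : C) (f : c ⟶ c), IsIso f) {X Y : C} (f : X ⟶ Y) (g : Y ⟶ X) : IsIso f := by
  have := hendo X (f ≫ g)
  have := hendo Y (g ≫ f)
  have : Mono f := mono_of_mono f g
  have : IsSplitEpi f := IsSplitEpi.mk' ⟨inv (g ≫ f) ≫ g, by simp⟩
  exact isIso_of_mono_of_isSplitEpi f

/-- In a composable chain of morphisms, each object maps to every later one. -/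
lemma nonempty_hom_of_le_of_chain {C : Type*} [Category C] {n : ℕ} {a : Fin (n + 1) → C}
    (f : ∀ i : Fin n, a i.castSucc ⟶ a i.succ) {i j : Fin (n + 1)} (hij : i ≤ j) :
    Nonempty (a i ⟶ a j) := by
  induction j using Fin.induction with
  | zero => obtain rfl := Fin.le_zero_iff.mp hij; exact ⟨𝟙 _⟩
  | succ k ih =>
    obtain rfl | h := hij.eq_or_lt
    · exact ⟨𝟙 _⟩
    · obtain ⟨g⟩ := ih (Fin.le_castSucc_iff.mpr h)
      exact ⟨g ≫ f k⟩

/-- In a category `C` where every endomorphism is an isomorphism, given a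
composable chain `f i : a i ⟶ a (i+1)` (for `i = 0, …, n-1`) of morphisms none of which
is an isomorphism, the objects `a 0, …, a n` are pairwise non-isomorphic. In particular,
if `C` has finitely many isomorphism classes, i.e. the skeleton of `C` is finite, then
`n + 1` is at most the number `r` of isomorphism classes of objects. -/
theorem chain_of_noninvertibles_pairwise_nonisomorphic {C : Type*} [Category C]
    (hendo : ∀ (c : C) (f : c ⟶ c), IsIso f) (n : ℕ) (a : Fin (n + 1) → C)
    (f : ∀ i : Fin n, a i.castSucc ⟶ a i.succ) (hf : ∀ i : Fin n, ¬ IsIso (f i)) :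
    (∀ i j : Fin (n + 1), i ≠ j → IsEmpty (a i ≅ a j)) ∧
    (Finite (Skeleton C) → n + 1 ≤ Nat.card (Skeleton C)) := by
  have hlt : ∀ i j : Fin (n + 1), i < j → IsEmpty (a i ≅ a j) := by
    intro i j hij
    refine ⟨fun e => ?_⟩
    obtain ⟨k, rfl⟩ := Fin.exists_castSucc_eq.mpr (Fin.ne_last_of_lt hij)
    obtain ⟨g⟩ := nonempty_hom_of_le_of_chain f (Fin.castSucc_lt_iff_succ_le.mp hij)
    exact hf k (isIso_of_hom_of_forall_isIso_endo hendo (f k) (g ≫ e.inv))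
  have hne : ∀ i j : Fin (n + 1), i ≠ j → IsEmpty (a i ≅ a j) := fun i j hij =>
    hij.lt_or_gt.elim (hlt i j) fun h => ⟨fun e => (hlt j i h).false e.symm⟩
  refine ⟨hne, fun _ => ?_⟩
  have hinj : Function.Injective fun i => toSkeleton (a i) := fun i j h => by
    by_contra hij
    exact (hne i j hij).false (Skeleton.isoOfEq h)
  simpa using Nat.card_le_card_of_injective _ hinj
end

section
/- Let k be a field of characteristic zero, let N be a natural number, and let F be a functor from the category FinSet_{≤N} — whose objects are the finite sets Fin 0, Fin 1, …, Fin N and whose morphisms are all functions between them — to the category of k-vector spaces. For each pair m, n ≤ N, the linear map F(Fin m) → F(Fin n)_{S_n} sending v to the class of ∑_{f : Fin m → Fin n} F(f)(v) descends to the coinvariants F(Fin m)_{S_m}, so these components assemble into a well-defined k-linear endomorphism Φ of ⊕_{n=0}^{N} F(Fin n)_{S_n}. This endomorphism Φ is invertible. -/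
open CategoryTheory

/-- The category `FinSet_{≤N}` whose objects are the finite sets `Fin 0, …, Fin N`
and whose morphisms are all functions between them. -/
abbrev FinSetLE (N : ℕ) := Fin (N + 1)

instance (N : ℕ) : Category (FinSetLE N) where
  Hom i j := Fin i.val → Fin j.val
  id _ := id
  comp f g := g ∘ f

instance (N : ℕ) (i j : FinSetLE N) : Fintype (i ⟶ j) :=
  inferInstanceAs (Fintype (Fin i.val → Fin j.val))

/-- For `F : FinSet_{≤N} ⥤ Vect_k`, the submodule of `F(Fin n)` spanned by the elements
`v - F(σ)(v)` for automorphisms (= permutations) `σ` of `Fin n`; the quotient by it is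
the module of coinvariants `F(Fin n)_{S_n}`. -/
def symCoinvariantsKer {k : Type*} [Field k] {N : ℕ} (F : FinSetLE N ⥤ ModuleCat k)
    (i : FinSetLE N) : Submodule k (F.obj i) :=
  Submodule.span k {x | ∃ (α : Aut i) (v : F.obj i), x = v - F.map α.hom v}

open scoped Nat

section Triangular

variable {k ι : Type*} [Field k] {V : ι → Type*} [∀ i, AddCommGroup (V i)] [∀ i, Module k (V i)]

/-- A perturbation of an invertible diagonal map by a map which is strictly triangular with respect
to a well-founded relation is bijective. -/
lemma bijective_diagonal_add_of_wellFounded {r : ι → ι → Prop} (hr : WellFounded r) {c : ι → k}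
    (hc : ∀ j, c j ≠ 0) {t : (∀ i, V i) → ∀ i, V i}
    (ht : ∀ x y j, (∀ i, r i j → x i = y i) → t x j = t y j) :
    Function.Bijective fun (x : ∀ i, V i) j ↦ c j • x j + t x j := by
  classical
  constructor
  · intro x y hxy
    funext j
    induction j using hr.induction with
    | _ j ih =>
      have h := congrFun hxy j
      simp only [ht x y j ih, add_left_inj] at h
      exact smul_right_injective _ (hc j) h
  · intro y
    let step (j : ι) (x : ∀ i, r i j → V i) : V j :=
      (c j)⁻¹ • (y j - t (fun i ↦ if h : r i j then x i h else 0) j)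
    let x : ∀ i, V i := hr.fix step
    refine ⟨x, funext fun j ↦ ?_⟩
    have hx : x j = (c j)⁻¹ • (y j - t x j) := by
      rw [show x j = step j fun i _ ↦ x i from hr.fix_eq step j]
      simp only [step]
      congr 2
      exact ht _ _ _ fun i hi ↦ by simp [hi]
    dsimp only
    rw [hx, smul_inv_smul₀ (hc j), sub_add_cancel]

end Triangular

section Factorization

open Function

/-- The factorizations of a function into a surjection followed by an injection form a torsor under
the permutations of the middle set. -/
lemma card_surjective_injective_factorizations {α β γ : Type*} [Fintype β] [DecidableEq β]
    {e : α → β} (he : Surjective e) {m : β → γ} (hm : Injective m)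
    [Fintype {p : (α → β) × (β → γ) // (Surjective p.1 ∧ Injective p.2) ∧ p.2 ∘ p.1 = m ∘ e}] :
    Fintype.card {p : (α → β) × (β → γ) // (Surjective p.1 ∧ Injective p.2) ∧ p.2 ∘ p.1 = m ∘ e} =
      (Fintype.card β)! := by
  rw [← Fintype.card_perm]
  refine (Fintype.card_of_bijective (f := fun σ : Equiv.Perm β ↦
    ⟨(σ ∘ e, m ∘ σ.symm), ⟨σ.surjective.comp he, hm.comp σ.symm.injective⟩, by
      funext a; simp⟩) ⟨?_, ?_⟩).symm
  · intro σ τ h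
    exact Equiv.coe_fn_injective (he.injective_comp_right (congrArg (fun p ↦ p.1.1) h))
  · rintro ⟨⟨f, g⟩, ⟨hf, hg⟩, h⟩
    dsimp only at hf hg h
    have hrange : Set.range m = Set.range g := by
      rw [← he.range_comp m, ← hf.range_comp g, h]
    let σ : Equiv.Perm β :=
      (Equiv.ofInjective m hm).trans ((Equiv.setCongr hrange).trans (Equiv.ofInjective g hg).symm)
    have hσ (b : β) : g (σ b) = m b := by
      simp [σ, Equiv.apply_ofInjective_symm]
    refine ⟨σ, Subtype.ext (Prod.ext (funext fun a ↦ hg ?_) (funext fun b ↦ ?_))⟩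
    · simpa [hσ] using (congrFun h a).symm
    · simpa using (hσ (σ.symm b)).symm

/-- Every function out of `Fin a` factors as a surjection onto some `Fin r` followed by an
injection. -/
lemma exists_surjective_injective_factorization {a : ℕ} {γ : Type*} (h : Fin a → γ) :
    ∃ r ≤ a, ∃ (e : Fin a → Fin r) (m : Fin r → γ), Surjective e ∧ Injective m ∧ m ∘ e = h := by
  classical
  let E := Fintype.equivFin (Set.range h)
  have hE : Surjective (E ∘ Set.rangeFactorization h) :=
    E.surjective.comp Set.rangeFactorization_surjective
  refine ⟨_, by simpa using Fintype.card_le_of_surjective _ hE, _, fun b ↦ (E.symm b).1, hE,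
    Subtype.val_injective.comp E.symm.injective, ?_⟩
  funext x
  simp

lemma card_eq_of_factorizations {α β β' γ : Type*} [Fintype β] [Fintype β']
    {f : α → β} {g : β → γ} {f' : α → β'} {g' : β' → γ} (hf : Surjective f) (hg : Injective g)
    (hf' : Surjective f') (hg' : Injective g') (h : g ∘ f = g' ∘ f') :
    Fintype.card β = Fintype.card β' := by
  have hrange : Set.range g = Set.range g' := by
    rw [← hf.range_comp g, ← hf'.range_comp g', h]
  exact Fintype.card_congr ((Equiv.ofInjective g hg).trans
    ((Equiv.setCongr hrange).trans (Equiv.ofInjective g' hg').symm))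

end Factorization

section WeightedSum

variable {k : Type*} [Field k] {N : ℕ} (F : FinSetLE N ⥤ ModuleCat k)
  (w : ∀ i j : FinSetLE N, (i ⟶ j) → k)

/-- The coinvariants of the permutation action on `F(Fin n)`. -/
abbrev SymCoinvariants (i : FinSetLE N) := F.obj i ⧸ symCoinvariantsKer F i

/-- The map `F(Fin m) → F(Fin n)` given by `v ↦ ∑ f, w f • F(f)(v)`. -/
def weightedSum (i j : FinSetLE N) : F.obj i →ₗ[k] F.obj j :=
  ∑ f : i ⟶ j, w i j f • (F.map f).hom

/-- A weight on morphisms which is invariant under precomposition with automorphisms. -/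
def AutInvariant : Prop :=
  ∀ (i j : FinSetLE N) (α : Aut i) (f : i ⟶ j), w i j (α.hom ≫ f) = w i j f

lemma weightedSum_apply {i j : FinSetLE N} (v : F.obj i) :
    weightedSum F w i j v = ∑ f : i ⟶ j, w i j f • F.map f v := by
  simp [weightedSum]

variable {w}

lemma weightedSum_map_aut (hw : AutInvariant w) {i j : FinSetLE N} (α : Aut i) (v : F.obj i) :
    weightedSum F w i j (F.map α.hom v) = weightedSum F w i j v := by
  rw [weightedSum_apply, weightedSum_apply]
  refine Fintype.sum_equiv (α.homFromEquiv (Z := j)).symm _ _ fun f ↦ ?_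
  change _ = w i j (α.hom ≫ f) • F.map (α.hom ≫ f) v
  rw [hw, F.map_comp, ModuleCat.comp_apply]

lemma symCoinvariantsKer_le_comap_weightedSum (hw : AutInvariant w) (i j : FinSetLE N) :
    symCoinvariantsKer F i ≤ (symCoinvariantsKer F j).comap (weightedSum F w i j) := by
  refine Submodule.span_le.2 ?_
  rintro _ ⟨α, v, rfl⟩
  simp [weightedSum_map_aut F hw]

/-- The endomorphism of the direct sum of the coinvariants with components induced by
`v ↦ ∑ f, w f • F(f)(v)`. -/
def coinvariantsEnd (hw : AutInvariant w) :
    (∀ i, SymCoinvariants F i) →ₗ[k] (∀ i, SymCoinvariants F i) :=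
  LinearMap.pi fun j ↦ ∑ i, (Submodule.mapQ _ _ (weightedSum F w i j)
    (symCoinvariantsKer_le_comap_weightedSum F hw i j)).comp (LinearMap.proj i)

lemma coinvariantsEnd_apply (hw : AutInvariant w) (x : ∀ i, SymCoinvariants F i) (j : FinSetLE N) :
    coinvariantsEnd F hw x j = ∑ i, Submodule.mapQ _ _ (weightedSum F w i j)
      (symCoinvariantsKer_le_comap_weightedSum F hw i j) (x i) := by
  simp [coinvariantsEnd]

lemma coinvariantsEnd_mk (hw : AutInvariant w) (v : ∀ i, F.obj i) :
    coinvariantsEnd F hw (fun i ↦ Submodule.Quotient.mk (v i)) =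
      fun j ↦ Submodule.Quotient.mk (∑ i, weightedSum F w i j (v i)) := by
  funext j
  rw [coinvariantsEnd_apply, ← Submodule.mkQ_apply, map_sum]
  rfl

lemma coinvariantsEnd_single (hw : AutInvariant w) (i : FinSetLE N) (v : F.obj i) :
    coinvariantsEnd F hw (Pi.single i (Submodule.Quotient.mk v)) =
      fun j ↦ Submodule.Quotient.mk (weightedSum F w i j v) := by
  funext j
  rw [coinvariantsEnd_apply, Finset.sum_eq_single i]
  · simp
  · intro b _ hb
    simp [hb]
  · simp

lemma symCoinvariants_mk_map (i : FinSetLE N) (f : i ⟶ i) [IsIso f] (v : F.obj i) :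
    (Submodule.Quotient.mk (F.map f v) : SymCoinvariants F i) = Submodule.Quotient.mk v :=
  Eq.symm <| (Submodule.Quotient.eq (symCoinvariantsKer F i)).2 <|
    Submodule.subset_span ⟨asIso f, v, rfl⟩

lemma mapQ_weightedSum_self (hw : AutInvariant w) (i : FinSetLE N)
    (hiso : ∀ f : i ⟶ i, w i i f ≠ 0 → IsIso f) (x : SymCoinvariants F i) :
    Submodule.mapQ _ _ (weightedSum F w i i) (symCoinvariantsKer_le_comap_weightedSum F hw i i) x =
      (∑ f : i ⟶ i, w i i f) • x := by
  obtain ⟨v, rfl⟩ := Submodule.Quotient.mk_surjective _ x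
  rw [Submodule.mapQ_apply, weightedSum_apply, ← Submodule.mkQ_apply, map_sum, Finset.sum_smul]
  refine Finset.sum_congr rfl fun f _ ↦ ?_
  by_cases hf : w i i f = 0
  · simp [hf]
  · have := hiso f hf
    rw [map_smul, Submodule.mkQ_apply, symCoinvariants_mk_map]

lemma weightedSum_eq_zero {i j : FinSetLE N} (h : ∀ f : i ⟶ j, w i j f = 0) :
    weightedSum F w i j = 0 := by
  simp [weightedSum, h]

lemma coinvariantsEnd_bijective (hw : AutInvariant w) {r : FinSetLE N → FinSetLE N → Prop}
    (hr : WellFounded r) (htri : ∀ i j (f : i ⟶ j), w i j f ≠ 0 → i ≠ j → r i j)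
    (hiso : ∀ i (f : i ⟶ i), w i i f ≠ 0 → IsIso f) (hsum : ∀ i, ∑ f : i ⟶ i, w i i f ≠ 0) :
    Function.Bijective (coinvariantsEnd F hw) := by
  let t (x : ∀ i, SymCoinvariants F i) (j : FinSetLE N) : SymCoinvariants F j :=
    ∑ i ∈ Finset.univ.erase j, Submodule.mapQ _ _ (weightedSum F w i j)
      (symCoinvariantsKer_le_comap_weightedSum F hw i j) (x i)
  have h := bijective_diagonal_add_of_wellFounded hr hsum (t := t) fun x y j hxy ↦ by
    refine Finset.sum_congr rfl fun i hi ↦ ?_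
    by_cases hij : r i j
    · rw [hxy i hij]
    · have hz : weightedSum F w i j = 0 := weightedSum_eq_zero F fun f ↦ by
        by_contra hf
        exact hij (htri i j f hf (Finset.ne_of_mem_erase hi))
      simp [hz]
  convert h using 1
  funext x j
  rw [coinvariantsEnd_apply, ← Finset.add_sum_erase _ _ (Finset.mem_univ j),
    mapQ_weightedSum_self F hw j (hiso j)]

open Classical in
lemma coinvariantsEnd_comp {w' w'' : ∀ i j : FinSetLE N, (i ⟶ j) → k} (hw : AutInvariant w)
    (hw' : AutInvariant w') (hw'' : AutInvariant w'')
    (h : ∀ i j (f : i ⟶ j),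
      ∑ r, ∑ p : (i ⟶ r) × (r ⟶ j), (if p.1 ≫ p.2 = f then w i r p.1 * w' r j p.2 else 0) =
        w'' i j f) :
    (coinvariantsEnd F hw').comp (coinvariantsEnd F hw) = coinvariantsEnd F hw'' := by
  ext1 i
  refine LinearMap.ext fun x ↦ ?_
  obtain ⟨v, rfl⟩ := Submodule.Quotient.mk_surjective _ x
  simp only [LinearMap.comp_apply, LinearMap.single_apply, coinvariantsEnd_single,
    coinvariantsEnd_mk]
  funext j
  congr 1
  simp only [weightedSum_apply, ← h, Finset.sum_smul, map_sum]
  conv_rhs => rw [Finset.sum_comm]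
  refine Finset.sum_congr rfl fun r _ ↦ ?_
  conv_rhs => rw [Finset.sum_comm]
  rw [← Fintype.sum_prod_type' fun (f : i ⟶ r) (g : r ⟶ j) ↦
    w' r j g • F.map g (w i r f • F.map f v)]
  refine Finset.sum_congr rfl fun p _ ↦ ?_
  simp [ite_smul, smul_smul, mul_comm]

end WeightedSum

section Weights

open Function

variable (k : Type*) [Field k] {N : ℕ}

open Classical in
/-- The indicator function of the surjections. -/
noncomputable def surjectiveWeight (i j : FinSetLE N) (f : i ⟶ j) : k :=
  if Surjective (f : Fin i.val → Fin j.val) then 1 else 0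

open Classical in
/-- The indicator function of the injections, divided by the number of permutations of the
source. -/
noncomputable def injectiveWeight (i j : FinSetLE N) (f : i ⟶ j) : k :=
  if Injective (f : Fin i.val → Fin j.val) then ((i.val)! : k)⁻¹ else 0

lemma finSetLE_isIso_iff {i j : FinSetLE N} (f : i ⟶ j) :
    IsIso f ↔ Bijective (f : Fin i.val → Fin j.val) := by
  constructor
  · intro hf
    exact bijective_iff_has_inverse.2
      ⟨inv f, congrFun (IsIso.hom_inv_id f), congrFun (IsIso.inv_hom_id f)⟩
  · intro hf
    obtain ⟨g, hl, hr⟩ := bijective_iff_has_inverse.1 hf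
    exact ⟨g, funext hl, funext hr⟩

lemma autInvariant_surjectiveWeight : AutInvariant (N := N) (surjectiveWeight k) := by
  intro i j α f
  have hα := (finSetLE_isIso_iff α.hom).1 (Iso.isIso_hom α)
  exact if_congr (hα.surjective.of_comp_iff f) rfl rfl

lemma autInvariant_injectiveWeight : AutInvariant (N := N) (injectiveWeight k) := by
  intro i j α f
  have hα := (finSetLE_isIso_iff α.hom).1 (Iso.isIso_hom α)
  exact if_congr (Injective.of_comp_iff' f hα) rfl rfl

variable {k} [CharZero k] (F : FinSetLE N ⥤ ModuleCat k)

lemma coinvariantsEnd_surjectiveWeight_bijective :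
    Bijective (coinvariantsEnd F (autInvariant_surjectiveWeight k)) := by
  classical
  refine coinvariantsEnd_bijective F _ (r := (· > ·)) wellFounded_gt ?_ ?_ ?_
  · intro i j f hf hij
    have hf : Surjective f := by by_contra h; exact hf (if_neg h)
    exact lt_of_le_of_ne (by simpa using Fintype.card_le_of_surjective f hf) hij.symm
  · intro i f hf
    have hf : Surjective f := by by_contra h; exact hf (if_neg h)
    exact (finSetLE_isIso_iff f).2 (Finite.surjective_iff_bijective.1 hf)
  · intro i
    simp only [surjectiveWeight, Finset.sum_boole, Nat.cast_ne_zero]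
    exact Finset.card_ne_zero_of_mem (a := 𝟙 i) (Finset.mem_filter.2 ⟨Finset.mem_univ _, surjective_id⟩)

lemma coinvariantsEnd_injectiveWeight_bijective :
    Bijective (coinvariantsEnd F (autInvariant_injectiveWeight k)) := by
  classical
  refine coinvariantsEnd_bijective F _ (r := (· < ·)) wellFounded_lt ?_ ?_ ?_
  · intro i j f hf hij
    have hf : Injective f := by by_contra h; exact hf (if_neg h)
    exact lt_of_le_of_ne (by simpa using Fintype.card_le_of_injective f hf) hij
  · intro i f hf
    have hf : Injective f := by by_contra h; exact hf (if_neg h)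
    exact (finSetLE_isIso_iff f).2 (Finite.injective_iff_bijective.1 hf)
  · intro i
    simp only [injectiveWeight, ← Finset.sum_filter, Finset.sum_const, nsmul_eq_mul]
    refine mul_ne_zero (Nat.cast_ne_zero.2 ?_)
      (inv_ne_zero (Nat.cast_ne_zero.2 (Nat.factorial_ne_zero _)))
    exact Finset.card_ne_zero_of_mem (a := 𝟙 i) (Finset.mem_filter.2 ⟨Finset.mem_univ _, injective_id⟩)

open Classical in
lemma sum_surjectiveWeight_mul_injectiveWeight (i j : FinSetLE N) (h : i ⟶ j) :
    ∑ r, ∑ p : (i ⟶ r) × (r ⟶ j),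
      (if p.1 ≫ p.2 = h then surjectiveWeight k i r p.1 * injectiveWeight k r j p.2 else 0) =
        1 := by
  obtain ⟨r, hr, e, m, he, hm, rfl⟩ := exists_surjective_injective_factorization h
  have key (s : FinSetLE N) (p : (i ⟶ s) × (s ⟶ j)) :
      (if p.1 ≫ p.2 = m ∘ e then surjectiveWeight k i s p.1 * injectiveWeight k s j p.2 else 0) =
      if (Surjective p.1 ∧ Injective p.2) ∧ p.2 ∘ p.1 = m ∘ e then ((s.val)! : k)⁻¹ else 0 := by
    rw [show p.1 ≫ p.2 = p.2 ∘ p.1 from rfl]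
    by_cases h₁ : Surjective p.1 <;> by_cases h₂ : Injective p.2 <;>
      simp [surjectiveWeight, injectiveWeight, h₁, h₂]
  simp only [key]
  rw [Finset.sum_eq_single ⟨r, by omega⟩]
  · rw [← Finset.sum_filter, Finset.sum_const, nsmul_eq_mul, ← Fintype.card_subtype]
    have hcard := card_surjective_injective_factorizations he hm
    rw [Fintype.card_fin] at hcard
    convert mul_inv_cancel₀ (Nat.cast_ne_zero.2 (Nat.factorial_ne_zero r) : ((r ! : ℕ) : k) ≠ 0)
    exact (Fintype.card_congr (Equiv.refl _)).trans hcard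
  · intro s _ hs
    refine Finset.sum_eq_zero fun p _ ↦ if_neg ?_
    rintro ⟨⟨h₁, h₂⟩, h₃⟩
    exact hs (Fin.ext (by simpa using card_eq_of_factorizations h₁ h₂ he hm h₃))
  · simp

end Weights

/-- Let `k` be a field of characteristic zero, `N` a natural number, and
`F : FinSet_{≤N} ⥤ Vect_k` a functor. The maps `F(Fin m) → F(Fin n)_{S_n}` given by
`v ↦ [∑_{f : Fin m → Fin n} F(f)(v)]` descend to the coinvariants `F(Fin m)_{S_m}` and
assemble into a linear endomorphism `Φ` of `⊕_{n=0}^{N} F(Fin n)_{S_n}`; this `Φ` is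
invertible. -/
theorem finSetLE_linearization_bijective {k : Type*} [Field k] [CharZero k] (N : ℕ)
    (F : FinSetLE N ⥤ ModuleCat k) :
    ∃ Φ : ((i : FinSetLE N) → (F.obj i ⧸ symCoinvariantsKer F i)) →ₗ[k]
        ((i : FinSetLE N) → (F.obj i ⧸ symCoinvariantsKer F i)),
      (∀ (i : FinSetLE N) (v : F.obj i),
        Φ (Pi.single i (Submodule.Quotient.mk v)) =
          fun j => Submodule.Quotient.mk (∑ f : i ⟶ j, F.map f v)) ∧
      Function.Bijective Φ := by
  have hone : AutInvariant (N := N) fun _ _ _ ↦ (1 : k) := fun _ _ _ _ ↦ rfl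
  refine ⟨coinvariantsEnd F hone, fun i v ↦ ?_, ?_⟩
  · simp only [coinvariantsEnd_single, weightedSum_apply, one_smul]
  · rw [← coinvariantsEnd_comp F (autInvariant_surjectiveWeight k) (autInvariant_injectiveWeight k)
      hone sum_surjectiveWeight_mul_injectiveWeight, LinearMap.coe_comp]
    exact (coinvariantsEnd_injectiveWeight_bijective F).comp
      (coinvariantsEnd_surjectiveWeight_bijective F)
end
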